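/- Let E : H → ℝ be a C¹ functional on a Hilbert space H = H⁻ ⊕ H⁺ with dim H⁻ < ∞. Suppose (a) there is a bounded neighborhood D of 0 in H⁻ and α ∈ ℝ with E ≤ α on ∂D; (b) there is β > α with E ≥ β on H⁺; (c) E satisfies the Palais–Smale condition. Then E has a critical point u ∈ H (with critical value ≥ β obtained via the minimax over maps from D̄ into H agreeing with the identity on ∂D). -/

import Mathlib

open Filter Bornology
open Set Metric MeasureTheory
open scoped NNReal Topology

theorem exists_det_one_add_eq_sum (V : Type*) [NormedAddCommGroup V] [NormedSpace ℝ V]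
    [FiniteDimensional ℝ V] {τ : ℝ} (hτ : 0 < τ) :
    ∃ (s : Finset ℝ) (c : ℝ → ℝ), (∀ t ∈ s, 0 < t ∧ t < τ) ∧ ∑ t ∈ s, c t = 1 ∧
      ∀ A : V →L[ℝ] V, (1 + A).det = ∑ t ∈ s, c t * (1 + t • A).det := by
  classical
  obtain ⟨s, hs, hcard⟩ :=
    (Set.Ioo_infinite hτ).exists_subset_card_eq (Module.finrank ℝ V + 1)
  have hne : s.Nonempty := Finset.card_pos.mp (by omega)
  have hinj : Set.InjOn (id : ℝ → ℝ) s := Function.injective_id.injOn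
  refine ⟨s, fun t => (Lagrange.basis s id t).eval 1, fun t ht => hs ht, ?_, fun A => ?_⟩
  · rw [← Polynomial.eval_finsetSum, Lagrange.sum_basis hinj hne, Polynomial.eval_one]
  · let b := Module.finBasis ℝ V
    let M := LinearMap.toMatrix b b (A : V →ₗ[ℝ] V)
    let p : Polynomial ℝ := Matrix.det ((Polynomial.X : Polynomial ℝ) •
      M.map Polynomial.C + (1 : Matrix _ _ ℝ).map Polynomial.C)
    have hp : ∀ t : ℝ, p.eval t = (1 + t • A).det := by
      intro t
      have h1 : (1 + t • A).det = LinearMap.det (1 + t • (A : V →ₗ[ℝ] V)) := rfl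
      rw [h1, ← LinearMap.det_toMatrix b, ← Polynomial.coe_evalRingHom, RingHom.map_det]
      congr 1
      ext i j
      by_cases hij : i = j <;>
        simp [LinearMap.toMatrix_one, M, hij, add_comm, mul_comm t]
    have hdeg : p.degree < s.card := by
      rw [hcard]
      refine lt_of_le_of_lt Polynomial.degree_le_natDegree ?_
      have := Polynomial.natDegree_det_X_add_C_le M 1
      rw [Fintype.card_fin] at this
      exact_mod_cast Nat.lt_succ_of_le this
    have := congrArg (Polynomial.eval 1) (Lagrange.eq_interpolate hinj hdeg)
    rw [hp, one_smul, Lagrange.interpolate_apply, Polynomial.eval_finsetSum] at this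
    rw [this]
    refine Finset.sum_congr rfl fun t _ => ?_
    rw [Polynomial.eval_mul, Polynomial.eval_C, hp, mul_comm, id]

theorem LipschitzWith.bijective_id_add {V : Type*} [NormedAddCommGroup V] [CompleteSpace V]
    {g : V → V} {K : ℝ≥0} (hg : LipschitzWith K g) (hK : K < 1) :
    Function.Bijective fun x => x + g x := by
  constructor
  · intro x y hxy
    have h1 : ‖x - y‖ ≤ K * ‖x - y‖ := by
      have h2 : x - y = g y - g x := by
        have : x + g x = y + g y := hxy
        rw [sub_eq_sub_iff_add_eq_add, this, add_comm]
      calc ‖x - y‖ = ‖g y - g x‖ := by rw [h2]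
        _ ≤ K * ‖y - x‖ := hg.norm_sub_le y x
        _ = K * ‖x - y‖ := by rw [norm_sub_rev]
    have hK' : (K : ℝ) < 1 := hK
    have : ‖x - y‖ = 0 := by nlinarith [norm_nonneg (x - y)]
    exact sub_eq_zero.mp (norm_eq_zero.mp this)
  · intro y
    have hc : ContractingWith K fun x => y - g x := by
      refine ⟨hK, LipschitzWith.of_dist_le_mul fun a b => ?_⟩
      rw [dist_sub_left]
      exact hg.dist_le_mul a b
    refine ⟨ContractingWith.fixedPoint _ hc, ?_⟩
    have := hc.fixedPoint_isFixedPt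
    exact (eq_sub_iff_add_eq.mp this.symm)

theorem det_one_add_pos {V : Type*} [NormedAddCommGroup V] [NormedSpace ℝ V]
    [FiniteDimensional ℝ V] {A : V →L[ℝ] V} (hA : ‖A‖ < 1) : 0 < (1 + A).det := by
  have : CompleteSpace V := FiniteDimensional.complete ℝ V
  have hne : ∀ s ∈ Icc (0 : ℝ) 1, (1 + s • A).det ≠ 0 := by
    intro s hs h0
    have hs1 : ‖s • A‖ < 1 := by
      rw [norm_smul, Real.norm_of_nonneg hs.1]
      nlinarith [hs.2, hs.1, norm_nonneg A]
    have hK : (‖s • A‖₊ : ℝ≥0) < 1 := hs1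
    have hb := (s • A).lipschitz.bijective_id_add hK
    have hlt := LinearMap.bot_lt_ker_of_det_eq_zero (f := ((1 + s • A : V →L[ℝ] V) : V →ₗ[ℝ] V)) h0
    exact hlt.ne' (LinearMap.ker_eq_bot.mpr hb.1)
  have hcont : ContinuousOn (fun s : ℝ => (1 + s • A).det) (Icc 0 1) :=
    (ContinuousLinearMap.continuous_det.comp (by fun_prop)).continuousOn
  by_contra hneg
  push Not at hneg
  have hmem : (0 : ℝ) ∈ Icc ((1 + (1 : ℝ) • A).det) ((1 + (0 : ℝ) • A).det) := by
    constructor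
    · simpa using hneg
    · simp [ContinuousLinearMap.det]
  obtain ⟨s, hs, hs0⟩ := intermediate_value_Icc' zero_le_one hcont hmem
  exact hne s hs hs0

theorem lipschitzWith_indicator_closedBall {V W : Type*} [NormedAddCommGroup V]
    [NormedSpace ℝ V] [NormedAddCommGroup W] {g : V → W} {ρ : ℝ} (hρ : 0 < ρ) {K : ℝ≥0}
    (hg : LipschitzOnWith K g (closedBall 0 ρ)) (h0 : ∀ x, ‖x‖ = ρ → g x = 0) :
    LipschitzWith K ((closedBall (0 : V) ρ).indicator g) := by
  have key : ∀ x y : V, x ∈ closedBall (0 : V) ρ → y ∉ closedBall (0 : V) ρ →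
      ‖g x‖ ≤ K * ‖x - y‖ := by
    intro x y hx hy
    rw [mem_closedBall_zero_iff] at hx hy
    push Not at hy
    have hy0 : 0 < ‖y‖ := hρ.trans hy
    obtain ⟨θ, hθ, hθρ⟩ : ∃ θ ∈ Icc (0 : ℝ) 1, ‖AffineMap.lineMap x y θ‖ = ρ := by
      have hc : ContinuousOn (fun θ : ℝ => ‖AffineMap.lineMap x y θ‖) (Icc 0 1) :=
        (AffineMap.lineMap_continuous.norm).continuousOn
      exact intermediate_value_Icc zero_le_one hc (by simp [hx, hy.le])
    have h1 := hg.norm_sub_le (mem_closedBall_zero_iff.mpr hx)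
      (mem_closedBall_zero_iff.mpr hθρ.le)
    rw [h0 _ hθρ, sub_zero] at h1
    refine h1.trans (mul_le_mul_of_nonneg_left ?_ K.2)
    rw [← dist_eq_norm, dist_left_lineMap, dist_eq_norm, Real.norm_of_nonneg hθ.1]
    exact mul_le_of_le_one_left (norm_nonneg _) hθ.2
  refine LipschitzWith.of_dist_le_mul fun x y => ?_
  rw [dist_eq_norm, dist_eq_norm]
  by_cases hx : x ∈ closedBall (0 : V) ρ <;> by_cases hy : y ∈ closedBall (0 : V) ρ
  · simpa [indicator_of_mem hx, indicator_of_mem hy] using hg.norm_sub_le hx hy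
  · simpa [indicator_of_mem hx, indicator_of_notMem hy] using key x y hx hy
  · simpa [indicator_of_notMem hx, indicator_of_mem hy, norm_sub_rev x y] using key y x hy hx
  · simp only [indicator_of_notMem hx, indicator_of_notMem hy, sub_zero, norm_zero]
    positivity

theorem not_exists_contDiff_retraction_sphere {V : Type*} [NormedAddCommGroup V]
    [InnerProductSpace ℝ V] [FiniteDimensional ℝ V] {r : V → V} {ρ : ℝ} (hρ : 0 < ρ)
    (hr : ContDiff ℝ 1 r) (hnorm : ∀ x, ‖r x‖ = ρ) (hid : ∀ x, ‖x‖ = ρ → r x = x) : False := by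
  have : CompleteSpace V := FiniteDimensional.complete ℝ V
  let _ : MeasurableSpace V := borel V
  have : BorelSpace V := ⟨rfl⟩
  let μ : Measure V := Measure.addHaar
  have hdr : ∀ x, HasFDerivAt r (fderiv ℝ r x) x := fun x =>
    (hr.differentiable one_ne_zero x).hasFDerivAt
  have hdc : Continuous (fderiv ℝ r) := hr.continuous_fderiv one_ne_zero
  let A : V → V →L[ℝ] V := fun x => fderiv ℝ r x - 1
  have hA : Continuous A := hdc.sub continuous_const
  obtain ⟨K, hK⟩ : ∃ K : ℝ≥0, ∀ x ∈ closedBall (0 : V) ρ, ‖A x‖₊ ≤ K := by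
    obtain ⟨C, hC⟩ := (isCompact_closedBall (0 : V) ρ).exists_bound_of_continuousOn
      hA.continuousOn
    exact ⟨C.toNNReal, fun x hx => NNReal.coe_le_coe.mp ((hC x hx).trans (Real.le_coe_toNNReal C))⟩
  have hdA : ∀ x, HasFDerivAt (fun x => r x - x) (A x) x := fun x => (hdr x).sub (hasFDerivAt_id x)
  have hlip : LipschitzWith K ((closedBall (0 : V) ρ).indicator fun x => r x - x) := by
    refine lipschitzWith_indicator_closedBall hρ ?_ fun x hx => by rw [hid x hx, sub_self]
    exact (convex_closedBall 0 ρ).lipschitzOnWith_of_nnnorm_hasFDerivWithin_le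
      (fun x _ => (hdA x).hasFDerivWithinAt) hK
  set G := (closedBall (0 : V) ρ).indicator fun x => r x - x with hG
  have hG0 : ∀ x, x ∉ ball (0 : V) ρ → G x = 0 := by
    intro x hx
    by_cases hx' : x ∈ closedBall (0 : V) ρ
    · have : ‖x‖ = ρ := by
        rw [mem_ball_zero_iff, not_lt] at hx
        exact le_antisymm (mem_closedBall_zero_iff.mp hx') hx
      simp [hG, hid x this]
    · exact indicator_of_notMem hx' _
  have hint : ∀ t : ℝ, IntegrableOn (fun x => (1 + t • A x).det) (ball 0 ρ) μ := fun t =>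
    ((ContinuousLinearMap.continuous_det.comp (by fun_prop)).continuousOn.integrableOn_compact
      (isCompact_closedBall (0 : V) ρ)).mono_set ball_subset_closedBall
  have hsmall : ∀ t : ℝ, 0 < t → t * K < 1 →
      ∫ x in ball 0 ρ, (1 + t • A x).det ∂μ = μ.real (ball 0 ρ) := by
    intro t ht htK
    have hlt : LipschitzWith (t.toNNReal * K) fun x => t • G x := by
      refine LipschitzWith.of_dist_le_mul fun x y => ?_
      rw [dist_smul₀, Real.norm_of_nonneg ht.le, NNReal.coe_mul, Real.coe_toNNReal t ht.le,
        mul_assoc]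
      exact mul_le_mul_of_nonneg_left (hlip.dist_le_mul x y) ht.le
    have hbij := hlt.bijective_id_add (by
      rw [← NNReal.coe_lt_coe, NNReal.coe_mul, Real.coe_toNNReal t ht.le]; exact htK)
    have himg : (fun x => x + t • G x) '' ball 0 ρ = ball 0 ρ := by
      rw [← compl_inj_iff, ← image_compl_eq hbij]
      conv_rhs => rw [← image_id (ball (0 : V) ρ)ᶜ]
      exact image_congr fun x hx => by simp [hG0 x hx]
    have hder : ∀ x ∈ ball (0 : V) ρ,
        HasFDerivWithinAt (fun x => x + t • G x) (1 + t • A x) (ball 0 ρ) x := by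
      intro x hx
      have h1 : HasFDerivAt (fun x => x + t • (r x - x)) (1 + t • A x) x :=
        (hasFDerivAt_id x).add ((hdA x).const_smul t)
      refine h1.hasFDerivWithinAt.congr' (fun y hy => ?_) hx
      simp only [hG, indicator_of_mem (ball_subset_closedBall hy)]
    have hcv := integral_image_eq_integral_abs_det_fderiv_smul μ measurableSet_ball hder
      hbij.1.injOn (fun _ => (1 : ℝ))
    rw [himg] at hcv
    simp only [smul_eq_mul, mul_one, setIntegral_const] at hcv
    rw [hcv]
    refine setIntegral_congr_fun measurableSet_ball fun x hx => ?_
    refine (abs_of_pos (det_one_add_pos ?_)).symm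
    rw [norm_smul, Real.norm_of_nonneg ht.le]
    exact lt_of_le_of_lt
      (mul_le_mul_of_nonneg_left (NNReal.coe_le_coe.mpr (hK x (ball_subset_closedBall hx))) ht.le)
      htK
  obtain ⟨s, c, hs, hc1, hdet⟩ := exists_det_one_add_eq_sum V
    (τ := 1 / (K + 1 : ℝ)) (by positivity)
  have hone : ∫ x in ball 0 ρ, (1 + A x).det ∂μ = μ.real (ball 0 ρ) := by
    rw [setIntegral_congr_fun measurableSet_ball fun x _ => hdet (A x),
      integral_finsetSum _ fun t _ => (hint t).const_mul (c t)]
    simp_rw [integral_const_mul]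
    rw [Finset.sum_congr rfl fun t ht => ?_, ← Finset.sum_mul, hc1, one_mul]
    rw [hsmall t (hs t ht).1]
    have h2 := (hs t ht).2
    rw [lt_div_iff₀ (by positivity)] at h2
    nlinarith [(hs t ht).1]
  have hzero : ∀ x, (1 + A x).det = 0 := by
    intro x
    by_contra hne
    have hA1 : 1 + A x = fderiv ℝ r x := add_sub_cancel _ _
    rw [hA1] at hne
    have hort : ∀ v, inner ℝ (r x) (fderiv ℝ r x v) = 0 := by
      intro v
      have h1 := (hdr x).norm_sq
      have h2 : HasFDerivAt (fun y => ‖r y‖ ^ 2) (0 : V →L[ℝ] ℝ) x := by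
        simp_rw [hnorm]; exact hasFDerivAt_const _ _
      have h3 := congrArg (fun L : V →L[ℝ] ℝ => L v) (h1.unique h2)
      simpa using h3
    have hu : IsUnit ((fderiv ℝ r x : V →L[ℝ] V) : V →ₗ[ℝ] V) :=
      (LinearMap.isUnit_iff_isUnit_det _).mpr (isUnit_iff_ne_zero.mpr hne)
    obtain ⟨v, hv⟩ := ((Module.End.isUnit_iff _).mp hu).2 (r x)
    have h4 := hort v
    rw [show fderiv ℝ r x v = r x from hv, real_inner_self_eq_norm_sq, hnorm] at h4
    exact (pow_pos hρ 2).ne' h4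
  simp_rw [hzero, integral_zero] at hone
  have : 0 < μ.real (ball (0 : V) ρ) :=
    ENNReal.toReal_pos (measure_ball_pos μ 0 hρ).ne' measure_ball_lt_top.ne
  exact this.ne hone

theorem Continuous.exists_eq_zero_of_eq_id_off_isBounded {V : Type*} [NormedAddCommGroup V]
    [InnerProductSpace ℝ V] [FiniteDimensional ℝ V] {F : V → V} (hF : Continuous F) {B : Set V}
    (hB : IsBounded B) (hid : ∀ x, x ∉ B → F x = x) : ∃ x, F x = 0 := by
  by_contra! hne
  obtain ⟨R, hR, hBR⟩ := hB.subset_ball_lt 0 0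
  obtain ⟨g, hg, happ, hsupp⟩ := (hF.sub continuous_id).exists_contDiff_approx (1 : ℕ∞)
    (ε := fun x => ‖F x‖) hF.norm fun x => norm_pos_iff.mpr (hne x)
  have hne' : ∀ x, x + g x ≠ 0 := by
    intro x hx
    have h1 := happ x
    rw [eq_neg_of_add_eq_zero_right hx, dist_eq_norm] at h1
    simp [← neg_add', add_sub_cancel] at h1
  have hc : ContDiff ℝ 1 fun x => x + g x := contDiff_id.add hg
  have hg0 : ∀ x, ‖x‖ = R → g x = 0 := by
    intro x hx
    by_contra h
    have h1 := hsupp h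
    refine h1 (sub_eq_zero.mpr (hid x fun hxB => ?_))
    have := mem_ball_zero_iff.mp (hBR hxB)
    exact this.ne hx
  refine not_exists_contDiff_retraction_sphere hR
    (r := fun x => (R * ‖x + g x‖⁻¹) • (x + g x)) ?_ (fun x => ?_) fun x hx => ?_
  · exact (contDiff_const.mul ((hc.norm ℝ hne').inv fun x => norm_ne_zero_iff.mpr (hne' x))).smul hc
  · rw [norm_smul, Real.norm_of_nonneg (by positivity), mul_assoc,
      inv_mul_cancel₀ (norm_ne_zero_iff.mpr (hne' x)), mul_one]
  · simp only [hg0 x hx, add_zero, hx, mul_inv_cancel₀ hR.ne', one_smul]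

theorem exists_eq_zero_of_eq_id_on_frontier {V : Type*} [NormedAddCommGroup V]
    [InnerProductSpace ℝ V] [FiniteDimensional ℝ V] {D : Set V} (hD0 : D ∈ 𝓝 (0 : V))
    (hDb : IsBounded D) (f : C(closure D, V))
    (hf : ∀ x : closure D, (x : V) ∈ frontier D → f x = x) : ∃ x, f x = 0 := by
  classical
  let F : V → V := fun x => if h : x ∈ closure D then f ⟨x, h⟩ else x
  have hF : Continuous F := by
    have huniv : closure D ∪ closure (closure D)ᶜ = univ :=
      eq_univ_of_univ_subset ((union_compl_self (closure D)).symm.subset.trans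
        (union_subset_union_right _ subset_closure))
    rw [← continuousOn_univ, ← huniv]
    refine ContinuousOn.union_of_isClosed ?_ ?_ isClosed_closure isClosed_closure
    · rw [continuousOn_iff_continuous_domRestrict]
      refine f.continuous.congr fun x => ?_
      simp [F]
    · refine continuousOn_id.congr fun x hx => ?_
      by_cases h : x ∈ closure D
      · have hfr : x ∈ frontier D := frontier_closure_subset <| by
          rw [frontier_eq_closure_inter_closure, closure_closure]
          exact ⟨h, hx⟩
        simpa only [F, dif_pos h, id] using hf ⟨x, h⟩ hfr
      · exact dif_neg h
  obtain ⟨x, hx⟩ := hF.exists_eq_zero_of_eq_id_off_isBounded hDb.closure fun x hx => dif_neg hx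
  by_cases h : x ∈ closure D
  · exact ⟨⟨x, h⟩, by simpa only [F, dif_pos h] using hx⟩
  · simp only [F, dif_neg h] at hx
    exact (h (hx ▸ subset_closure (mem_of_mem_nhds hD0))).elim

theorem Continuous.exists_almost_minimizer {X : Type*} [PseudoMetricSpace X] [CompleteSpace X]
    {f : X → ℝ} (hf : Continuous f) (hb : BddBelow (range f)) {ε : ℝ} (hε : 0 < ε) (x₀ : X) :
    ∃ x, f x ≤ f x₀ ∧ ∀ y, f x - ε * dist x y ≤ f y := by
  let S : X → Set X := fun x => {y | f y + ε * dist x y ≤ f x}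
  have hself : ∀ x, x ∈ S x := fun x => by simp [S]
  have htrans : ∀ {x y z}, y ∈ S x → z ∈ S y → z ∈ S x := by
    intro x y z hy hz
    have h1 : f y + ε * dist x y ≤ f x := hy
    have h2 : f z + ε * dist y z ≤ f y := hz
    have h3 := mul_le_mul_of_nonneg_left (dist_triangle x y z) hε.le
    change f z + ε * dist x z ≤ f x
    linarith
  have hstep : ∀ (n : ℕ) (x : X), ∃ x' ∈ S x, ∀ y ∈ S x, f x' ≤ f y + 1 / (n + 1 : ℝ) := by
    intro n x
    obtain ⟨_, ⟨x', hx', rfl⟩, hlt⟩ := Real.lt_sInf_add_pos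
      (⟨f x, x, hself x, rfl⟩ : (f '' S x).Nonempty) (ε := 1 / (n + 1 : ℝ)) (by positivity)
    refine ⟨x', hx', fun y hy => hlt.le.trans ?_⟩
    gcongr
    exact csInf_le (hb.mono (image_subset_range _ _)) ⟨y, hy, rfl⟩
  choose next hnext hnext_le using hstep
  let u : ℕ → X := fun n => Nat.rec x₀ next n
  have husucc : ∀ n, u (n + 1) = next n (u n) := fun n => rfl
  have hmem : ∀ n m, n ≤ m → u m ∈ S (u n) := by
    intro n m hnm
    induction m, hnm using Nat.le_induction with
    | base => exact hself _
    | succ m _ ih => exact htrans ih (husucc m ▸ hnext m (u m))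
  have hanti : Antitone fun n => f (u n) := by
    intro n m hnm
    have h1 : f (u m) + ε * dist (u n) (u m) ≤ f (u n) := hmem n m hnm
    have h2 : 0 ≤ ε * dist (u n) (u m) := by positivity
    change f (u m) ≤ f (u n)
    linarith
  obtain ⟨l, hl⟩ : ∃ l, Tendsto (fun n => f (u n)) atTop (𝓝 l) :=
    ⟨_, tendsto_atTop_ciInf hanti (hb.mono (range_comp_subset_range u f))⟩
  have hl_le : ∀ n, l ≤ f (u n) := fun n => hanti.le_of_tendsto hl n
  have hcauchy : CauchySeq u := by
    refine cauchySeq_of_le_tendsto_0' (fun n => (f (u n) - l) / ε) (fun n m hnm => ?_) ?_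
    · rw [le_div_iff₀ hε]
      have h1 : f (u m) + ε * dist (u n) (u m) ≤ f (u n) := hmem n m hnm
      linarith [hl_le m]
    · simpa using (hl.sub_const l).div_const ε
  obtain ⟨x, hx⟩ := cauchySeq_tendsto_of_complete hcauchy
  have hfx : f x = l := tendsto_nhds_unique ((hf.tendsto x).comp hx) hl
  have hxS : ∀ n, x ∈ S (u n) := by
    intro n
    have hclosed : IsClosed (S (u n)) := isClosed_le (by fun_prop) continuous_const
    exact hclosed.mem_of_tendsto hx ((eventually_ge_atTop n).mono fun m hm => hmem n m hm)
  refine ⟨x, hfx ▸ hl_le 0, fun y => ?_⟩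
  by_contra! hlt
  have hy : y ∈ S x := by change f y + ε * dist x y ≤ f x; linarith
  have h1 : l ≤ f y := by
    have h2 : Tendsto (fun n : ℕ => f y + 1 / (n + 1 : ℝ)) atTop (𝓝 (f y)) := by
      simpa using tendsto_one_div_add_atTop_nhds_zero_nat.const_add (f y)
    exact ge_of_tendsto' h2 fun n =>
      (hl_le (n + 1)).trans (husucc n ▸ hnext_le n (u n) y (htrans (hxS n) hy))
  have h2 : 0 ≤ ε * dist x y := by positivity
  linarith

section Minimax

variable {H K : Type*} [NormedAddCommGroup H] [MetricSpace K] [CompactSpace K]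

theorem continuous_sSup_range_comp {E : H → ℝ} (hE : Continuous E) :
    Continuous fun γ : C(K, H) => sSup (range fun x => E (γ x)) := by
  simp_rw [← image_univ]
  exact isCompact_univ.continuous_sSup
    (hE.comp (continuous_fst.eval continuous_snd))

theorem le_sSup_range_comp {E : H → ℝ} (hE : Continuous E) (γ : C(K, H)) (x : K) :
    E (γ x) ≤ sSup (range fun x => E (γ x)) :=
  le_csSup (isCompact_range (hE.comp γ.continuous)).bddAbove (mem_range_self x)

theorem exists_eq_sSup_range_comp [Nonempty K] {E : H → ℝ} (hE : Continuous E) (γ : C(K, H)) :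
    ∃ x, E (γ x) = sSup (range fun x => E (γ x)) :=
  (isCompact_range (hE.comp γ.continuous)).sSup_mem (range_nonempty _)

theorem exists_maximizer_le_fderiv [NormedSpace ℝ H] [Nonempty K] {E : H → ℝ}
    (hE : ContDiff ℝ 1 E) {γ w : C(K, H)} (hw : ∀ x, ‖w x‖ ≤ 1) {ε : ℝ}
    (hγ : ∀ t : ℝ, 0 < t → sSup (range fun x => E (γ x)) - ε * t ≤
      sSup (range fun x => E ((γ + t • w) x))) :
    ∃ x, E (γ x) = sSup (range fun x => E (γ x)) ∧ -ε ≤ fderiv ℝ E (γ x) (w x) := by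
  set Φ : C(K, H) → ℝ := fun γ => sSup (range fun x => E (γ x))
  have hΦc : Continuous Φ := continuous_sSup_range_comp hE.continuous
  choose z hz using fun n : ℕ =>
    exists_eq_sSup_range_comp hE.continuous (γ + (1 / (n + 1 : ℝ)) • w)
  obtain ⟨x, -, φ, hφ, hx⟩ := isCompact_univ.tendsto_subseq fun n => mem_univ (z n)
  let t : ℕ → ℝ := fun n => 1 / ((φ n : ℝ) + 1)
  have ht : ∀ n, 0 < t n := fun n => by positivity
  have ht0 : Tendsto t atTop (𝓝 0) :=
    tendsto_one_div_add_atTop_nhds_zero_nat.comp hφ.tendsto_atTop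
  let y : ℕ → K := fun n => z (φ n)
  have hy : Tendsto y atTop (𝓝 x) := hx
  have hyE : ∀ n, E (γ (y n) + t n • w (y n)) = Φ (γ + t n • w) := fun n => hz (φ n)
  have hq : Tendsto (fun n => γ (y n)) atTop (𝓝 (γ x)) := (γ.continuous.tendsto x).comp hy
  have hwy : Tendsto (fun n => w (y n)) atTop (𝓝 (w x)) := (w.continuous.tendsto x).comp hy
  have hp : Tendsto (fun n => γ (y n) + t n • w (y n)) atTop (𝓝 (γ x)) := by
    simpa using hq.add (ht0.smul hwy)
  have hlim : Tendsto (fun n => Φ (γ + t n • w)) atTop (𝓝 (Φ γ)) := by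
    have h1 : Tendsto (fun n => γ + t n • w) atTop (𝓝 γ) := by
      simpa using tendsto_const_nhds.add (ht0.smul_const w)
    exact (hΦc.tendsto γ).comp h1
  refine ⟨x, tendsto_nhds_unique ((hE.continuous.tendsto _).comp hp) ?_, ?_⟩
  · exact hlim.congr fun n => (hyE n).symm
  have hstrict := (hE.contDiffAt (x := γ x)).hasStrictFDerivAt one_ne_zero
  refine le_of_forall_pos_sub_le fun δ hδ => ?_
  have hev := (hp.prodMk_nhds hq).eventually (hstrict.isLittleO.def hδ)
  have hlimw : Tendsto (fun n => fderiv ℝ E (γ x) (w (y n))) atTop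
      (𝓝 (fderiv ℝ E (γ x) (w x))) := ((fderiv ℝ E (γ x)).continuous.tendsto _).comp hwy
  refine ge_of_tendsto hlimw (hev.mono fun n hn => ?_)
  simp only [add_sub_cancel_left, map_smul, smul_eq_mul, hyE, norm_smul] at hn
  have h1 : ‖t n‖ * ‖w (y n)‖ ≤ t n := by
    rw [Real.norm_of_nonneg (ht n).le]
    exact mul_le_of_le_one_right (ht n).le (hw _)
  have h2 := (abs_le.mp (hn.trans (mul_le_mul_of_nonneg_left h1 hδ.le))).2
  have h3 := hγ (t n) (ht n)
  have h4 : E (γ (y n)) ≤ Φ γ := le_sSup_range_comp hE.continuous γ (y n)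
  have h5 : t n * (-ε - δ) ≤ t n * fderiv ℝ E (γ x) (w (y n)) := by
    change Φ γ - ε * t n ≤ Φ (γ + t n • w) at h3
    linarith
  exact le_of_mul_le_mul_left h5 (ht n)

theorem exists_norm_fderiv_le_of_linking [InnerProductSpace ℝ H] [CompleteSpace H] [Nonempty K]
    {E : H → ℝ} (hE : ContDiff ℝ 1 E) {S : Set K} (γ₀ : C(K, H)) {α β : ℝ} (hαβ : α < β)
    (hα : ∀ x ∈ S, E (γ₀ x) ≤ α)
    (hβ : ∀ γ : C(K, H), EqOn γ γ₀ S → ∃ x, β ≤ E (γ x)) {ε : ℝ} (hε : 0 < ε) :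
    ∃ u, β ≤ E u ∧ E u ≤ sSup (range fun x => E (γ₀ x)) ∧ ‖fderiv ℝ E u‖ ≤ ε := by
  set Φ : C(K, H) → ℝ := fun γ => sSup (range fun x => E (γ x))
  have hΦc : Continuous Φ := continuous_sSup_range_comp hE.continuous
  let Γ : Set C(K, H) := {γ | EqOn γ γ₀ S}
  have hΓ : IsClosed Γ := by
    have : Γ = ⋂ x ∈ S, {γ : C(K, H) | γ x = γ₀ x} := by ext γ; simp [Γ, EqOn]
    rw [this]
    exact isClosed_biInter fun x _ => isClosed_eq (continuous_eval_const x) continuous_const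
  have hΦβ : ∀ γ ∈ Γ, β ≤ Φ γ := by
    intro γ hγ
    obtain ⟨x, hx⟩ := hβ γ hγ
    exact hx.trans (le_sSup_range_comp hE.continuous γ x)
  have : CompleteSpace Γ := hΓ.completeSpace_coe
  obtain ⟨⟨γ, hγΓ⟩, hγ₀, hmin⟩ := (hΦc.comp continuous_subtype_val).exists_almost_minimizer
    (f := fun γ : Γ => Φ γ) ⟨β, by rintro _ ⟨γ, rfl⟩; exact hΦβ γ γ.2⟩ hε
    ⟨γ₀, fun _ _ => rfl⟩
  let G : H → H := fun u => (InnerProductSpace.toDual ℝ H).symm (fderiv ℝ E u)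
  have hGn : ∀ u, ‖G u‖ = ‖fderiv ℝ E u‖ := fun u => LinearIsometryEquiv.norm_map _ _
  have hG : Continuous G :=
    (LinearIsometryEquiv.continuous _).comp (hE.continuous_fderiv one_ne_zero)
  have hGE : ∀ u, fderiv ℝ E u (G u) = ‖G u‖ ^ 2 := fun u => by
    rw [← real_inner_self_eq_norm_sq, InnerProductSpace.toDual_symm_apply]
  let cut : ℝ → ℝ := fun s => max 0 (min 1 ((s - α) / (β - α)))
  have hmax : ∀ u, 0 < max ‖G u‖ ε := fun u => hε.trans_le (le_max_right _ _)
  let w : C(K, H) :=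
    { toFun := fun x => -((cut (E (γ x)) * (max ‖G (γ x)‖ ε)⁻¹) • G (γ x))
      continuous_toFun := by
        have hE' := hE.continuous
        have h1 : Continuous fun x => (max ‖G (γ x)‖ ε)⁻¹ :=
          Continuous.inv₀ (by fun_prop) fun x => (hmax _).ne'
        fun_prop }
  have hcut0 : ∀ s, 0 ≤ cut s := fun s => le_max_left _ _
  have hcut1 : ∀ s, cut s ≤ 1 := fun s => max_le zero_le_one (min_le_left _ _)
  have hw : ∀ x, ‖w x‖ ≤ 1 := by
    intro x
    change ‖-((cut (E (γ x)) * (max ‖G (γ x)‖ ε)⁻¹) • G (γ x))‖ ≤ 1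
    have h1 : (max ‖G (γ x)‖ ε)⁻¹ * ‖G (γ x)‖ ≤ 1 :=
      (inv_mul_le_one₀ (hmax _)).mpr (le_max_left _ _)
    rw [norm_neg, norm_smul, Real.norm_of_nonneg
      (mul_nonneg (hcut0 _) (inv_nonneg.mpr (hmax _).le)), mul_assoc]
    exact mul_le_one₀ (hcut1 _) (mul_nonneg (inv_nonneg.mpr (hmax _).le) (norm_nonneg _)) h1
  have hwS : ∀ x ∈ S, w x = 0 := by
    intro x hx
    have h1 : cut (E (γ x)) = 0 := by
      refine max_eq_left ((min_le_right _ _).trans ?_)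
      refine div_nonpos_of_nonpos_of_nonneg ?_ (sub_pos.mpr hαβ).le
      rw [hγΓ hx]
      exact sub_nonpos.mpr (hα x hx)
    change -((cut (E (γ x)) * (max ‖G (γ x)‖ ε)⁻¹) • G (γ x)) = 0
    rw [h1, zero_mul, zero_smul, neg_zero]
  obtain ⟨x, hx, hwx⟩ := exists_maximizer_le_fderiv hE hw (γ := γ) (ε := ε) fun t ht => by
    have hmem : γ + t • w ∈ Γ := fun x hx => by simp [hwS x hx, hγΓ hx]
    refine le_trans ?_ (hmin ⟨γ + t • w, hmem⟩)
    rw [Subtype.dist_eq, dist_self_add_right, norm_smul, Real.norm_of_nonneg ht.le]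
    have h1 : ‖w‖ ≤ 1 := (ContinuousMap.norm_le w zero_le_one).mpr hw
    gcongr
    exact mul_le_of_le_one_right ht.le h1
  have hβx : β ≤ E (γ x) := hx ▸ hΦβ γ hγΓ
  refine ⟨γ x, hβx, hx ▸ hγ₀, ?_⟩
  by_contra! hlt
  rw [← hGn] at hlt
  have hcutx : cut (E (γ x)) = 1 := by
    have : 1 ≤ (E (γ x) - α) / (β - α) := by
      rw [one_le_div (sub_pos.mpr hαβ)]
      linarith
    simp [cut, min_eq_left this]
  have hwx' : w x = -(‖G (γ x)‖⁻¹ • G (γ x)) := by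
    change -((cut (E (γ x)) * (max ‖G (γ x)‖ ε)⁻¹) • G (γ x)) = _
    rw [hcutx, one_mul, max_eq_left hlt.le]
  rw [hwx', map_neg, map_smul, hGE, smul_eq_mul, sq, inv_mul_cancel_left₀ (hε.trans hlt).ne'] at hwx
  linarith

end Minimax

theorem Submodule.exists_isTopCompl_le_topologicalClosure {H : Type*} [NormedAddCommGroup H]
    [InnerProductSpace ℝ H] [CompleteSpace H] {Hm Hp : Submodule ℝ H} (h : Codisjoint Hm Hp)
    [FiniteDimensional ℝ Hm] : ∃ W ≤ Hp.topologicalClosure, Hm.IsTopCompl W := by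
  set C := Hp.topologicalClosure
  have hfin : FiniteDimensional ℝ (Hm ⊓ C : Submodule ℝ H) :=
    Submodule.finiteDimensional_of_le inf_le_left
  refine ⟨(Hm ⊓ C)ᗮ ⊓ C, inf_le_right, IsCompl.isTopCompl_of_isClosed ⟨?_, ?_⟩
    Hm.closed_of_finiteDimensional
    ((Submodule.isClosed_orthogonal _).inter Hp.isClosed_topologicalClosure)⟩
  · rw [disjoint_iff_inf_le]
    rintro x ⟨hx1, hx2, hx3⟩
    exact (Submodule.orthogonal_disjoint (Hm ⊓ C)).le_bot ⟨⟨hx1, hx3⟩, hx2⟩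
  · rw [codisjoint_iff_le_sup]
    have h1 : (Hm ⊓ C) ⊔ (Hm ⊓ C)ᗮ ⊓ C = C :=
      Submodule.sup_orthogonal_inf_of_hasOrthogonalProjection inf_le_right
    calc (⊤ : Submodule ℝ H) ≤ Hm ⊔ Hp := h.top_le
      _ ≤ Hm ⊔ C := sup_le_sup_left Hp.le_topologicalClosure _
      _ = Hm ⊔ ((Hm ⊓ C) ⊔ (Hm ⊓ C)ᗮ ⊓ C) := by rw [h1]
      _ ≤ Hm ⊔ (Hm ⊓ C)ᗮ ⊓ C :=
        sup_le le_sup_left (sup_le (inf_le_left.trans le_sup_left) le_sup_right)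

/-- Rabinowitz's Saddle Point Theorem: `E ∈ C¹(H,ℝ)`, `H = H⁻ ⊕ H⁺` with `dim H⁻ < ∞`;
(a) there is a bounded neighborhood `D` of `0` in `H⁻` and `α` with `E ≤ α` on `∂D`;
(b) there is `β > α` with `E ≥ β` on `H⁺`; (c) `E` satisfies the Palais–Smale condition.
Then `E` has a critical point, with critical value `≥ β`. -/
theorem stmt_19
    {H : Type*} [NormedAddCommGroup H] [InnerProductSpace ℝ H] [CompleteSpace H]
    (Hm Hp : Submodule ℝ H) (hcompl : IsCompl Hm Hp) [FiniteDimensional ℝ Hm]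
    (E : H → ℝ) (hE : ContDiff ℝ 1 E)
    (D : Set Hm) (hD0 : D ∈ nhds (0 : Hm)) (hDb : IsBounded D)
    (α β : ℝ) (hαβ : α < β)
    (ha : ∀ u ∈ frontier D, E (u : H) ≤ α)
    (hb : ∀ u ∈ Hp, β ≤ E u)
    (hPS : ∀ u : ℕ → H, (∃ C : ℝ, ∀ n, |E (u n)| ≤ C) →
      Tendsto (fun n => ‖fderiv ℝ E (u n)‖) atTop (nhds 0) →
      ∃ ψ : ℕ → ℕ, StrictMono ψ ∧ ∃ w : H, Tendsto (fun n => u (ψ n)) atTop (nhds w)) :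
    ∃ u : H, fderiv ℝ E u = 0 ∧ β ≤ E u := by
  obtain ⟨W, hW, hcW⟩ := Submodule.exists_isTopCompl_le_topologicalClosure hcompl.codisjoint
  have hβW : ∀ u ∈ W, β ≤ E u := fun u hu =>
    closure_minimal (t := {u | β ≤ E u}) hb (isClosed_le continuous_const hE.continuous) (hW hu)
  have : CompactSpace (closure D) := isCompact_iff_compactSpace.mp hDb.isCompact_closure
  have : Nonempty (closure D) := ⟨⟨0, subset_closure (mem_of_mem_nhds hD0)⟩⟩
  let γ₀ : C(closure D, H) := ⟨fun x => ((x : Hm) : H), by fun_prop⟩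
  let P := Hm.projectionOntoL W hcW
  have hlink : ∀ γ : C(closure D, H), EqOn γ γ₀ {x | (x : Hm) ∈ frontier D} →
      ∃ x, β ≤ E (γ x) := by
    intro γ hγ
    obtain ⟨x, hx⟩ := exists_eq_zero_of_eq_id_on_frontier hD0 hDb
      ⟨fun x => P (γ x), by fun_prop⟩ fun x hx => by
        change P (γ x) = x
        rw [hγ hx]
        exact Submodule.projectionOntoL_apply_left hcW x
    exact ⟨x, hβW _ ((Submodule.projectionOntoL_apply_eq_zero_iff hcW).mp hx)⟩
  choose u hu hu_le hu' using fun n : ℕ =>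
    exists_norm_fderiv_le_of_linking hE γ₀ hαβ (fun x hx => ha x hx) hlink
      (ε := 1 / (n + 1 : ℝ)) (by positivity)
  have hlim : Tendsto (fun n => ‖fderiv ℝ E (u n)‖) atTop (𝓝 0) :=
    squeeze_zero (fun n => norm_nonneg _) hu' tendsto_one_div_add_atTop_nhds_zero_nat
  obtain ⟨ψ, hψ, v, hv⟩ := hPS u ⟨_, fun n => abs_le_max_abs_abs (hu n) (hu_le n)⟩ hlim
  refine ⟨v, ?_, ge_of_tendsto' ((hE.continuous.tendsto v).comp hv) fun n => hu (ψ n)⟩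
  have h1 := (((hE.continuous_fderiv one_ne_zero).norm.tendsto v).comp hv)
  exact norm_eq_zero.mp (tendsto_nhds_unique h1 (hlim.comp hψ.tendsto_atTop))
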